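/- The Steiner quadruple system S(3,4,8) admits no non-crossing drawing by quadrilaterals in ℝ³: there do not exist an injective map p : {1, …, 8} → ℝ³ and, for each of the fourteen blocks b ∈ {{1,2,4,8}, {3,5,6,7}, {2,3,5,8}, {1,4,6,7}, {3,4,6,8}, {1,2,5,7}, {4,5,7,8}, {1,2,3,6}, {1,5,6,8}, {2,3,4,7}, {2,6,7,8}, {1,3,4,5}, {1,3,7,8}, {2,4,5,6}}, a filled quadrilateral Q_b ⊆ ℝ³ with corner set p(b), such that Q_b ∩ Q_{b'} = p(b ∩ b') for all distinct blocks b, b'. -/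

import Mathlib

/-- `Q` is a filled quadrilateral with corner set `s`: `s` consists of four distinct
coplanar points which, for some labeling `a, b, c, d`, split `Q` into the two triangles
`conv {a, b, c}` and `conv {a, c, d}` meeting exactly in the segment `[a, c]`. -/
def IsFilledQuadrilateral (Q s : Set (EuclideanSpace ℝ (Fin 3))) : Prop :=
  ∃ a b c d : EuclideanSpace ℝ (Fin 3),
    s = {a, b, c, d} ∧
    a ≠ b ∧ a ≠ c ∧ a ≠ d ∧ b ≠ c ∧ b ≠ d ∧ c ≠ d ∧
    Coplanar ℝ ({a, b, c, d} : Set (EuclideanSpace ℝ (Fin 3))) ∧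
    AffineIndependent ℝ ![a, b, c] ∧ AffineIndependent ℝ ![a, c, d] ∧
    convexHull ℝ ({a, b, c} : Set (EuclideanSpace ℝ (Fin 3))) ∩
      convexHull ℝ ({a, c, d} : Set (EuclideanSpace ℝ (Fin 3))) = segment ℝ a c ∧
    Q = convexHull ℝ ({a, b, c} : Set (EuclideanSpace ℝ (Fin 3))) ∪
      convexHull ℝ ({a, c, d} : Set (EuclideanSpace ℝ (Fin 3)))

/-- The fourteen blocks of the Steiner quadruple system `S(3,4,8)` on `{1, …, 8}`. -/
def sqs8Blocks : Finset (Finset ℕ) :=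
  {{1, 2, 4, 8}, {3, 5, 6, 7}, {2, 3, 5, 8}, {1, 4, 6, 7}, {3, 4, 6, 8}, {1, 2, 5, 7},
   {4, 5, 7, 8}, {1, 2, 3, 6}, {1, 5, 6, 8}, {2, 3, 4, 7}, {2, 6, 7, 8}, {1, 3, 4, 5},
   {1, 3, 7, 8}, {2, 4, 5, 6}}

/-- Of the segments joining a corner of a filled quadrilateral to two distinct corners, at least
one lies in the quadrilateral: only one diagonal may leave it. -/
theorem IsFilledQuadrilateral.segment_subset_or {Q s : Set (EuclideanSpace ℝ (Fin 3))}
    (h : IsFilledQuadrilateral Q s) {v x y : EuclideanSpace ℝ (Fin 3)}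
    (hv : v ∈ s) (hx : x ∈ s) (hy : y ∈ s) (hxy : x ≠ y) :
    segment ℝ v x ⊆ Q ∨ segment ℝ v y ⊆ Q := by
  obtain ⟨a, b, c, d, rfl, -, -, -, -, -, -, -, -, -, -, rfl⟩ := h
  have left {u w} (hu : u ∈ ({a, b, c} : Set _)) (hw : w ∈ ({a, b, c} : Set _)) :
      segment ℝ u w ⊆ convexHull ℝ {a, b, c} ∪ convexHull ℝ {a, c, d} :=
    (segment_subset_convexHull hu hw).trans Set.subset_union_left
  have right {u w} (hu : u ∈ ({a, c, d} : Set _)) (hw : w ∈ ({a, c, d} : Set _)) :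
      segment ℝ u w ⊆ convexHull ℝ {a, b, c} ∪ convexHull ℝ {a, c, d} :=
    (segment_subset_convexHull hu hw).trans Set.subset_union_right
  simp only [Set.mem_insert_iff, Set.mem_singleton_iff] at hv hx hy left right
  have lx := left (u := v) (w := x)
  have ly := left (u := v) (w := y)
  have rx := right (u := v) (w := x)
  have ry := right (u := v) (w := y)
  clear left right
  generalize (segment ℝ v x ⊆ _) = X at *
  generalize (segment ℝ v y ⊆ _) = Y at *
  grind

theorem segment_infinite {E : Type*} [AddCommGroup E] [Module ℝ E] {x y : E} (h : x ≠ y) :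
    (segment ℝ x y).Infinite := by
  rw [segment_eq_image_lineMap]
  exact (Set.Icc_infinite one_pos).image (AffineMap.lineMap_injective ℝ h).injOn

/-- **Proposition 3 of the paper.** The Steiner quadruple system
`S(3,4,8)` admits no non-crossing drawing by (convex or non-convex) quadrilaterals
in ℝ³. -/
theorem sqs8_no_quadrilateral_drawing :
    ¬ ∃ (p : ℕ → EuclideanSpace ℝ (Fin 3))
        (Q : Finset ℕ → Set (EuclideanSpace ℝ (Fin 3))),
      Set.InjOn p (Set.Icc 1 8) ∧
      (∀ b ∈ sqs8Blocks, IsFilledQuadrilateral (Q b) (p '' (b : Set ℕ))) ∧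
      (∀ b ∈ sqs8Blocks, ∀ b' ∈ sqs8Blocks, b ≠ b' →
        Q b ∩ Q b' = p '' ((b ∩ b' : Finset ℕ) : Set ℕ)) := by
  rintro ⟨p, Q, hp, hQ, hdisj⟩
  have one_of_two (b : Finset ℕ) (x y : ℕ)
      (h : b ∈ sqs8Blocks ∧ (1 ∈ b ∧ x ∈ b ∧ y ∈ b) ∧
        (1 < x ∧ x ≤ 8) ∧ (1 < y ∧ y ≤ 8) ∧ x ≠ y) :
      segment ℝ (p 1) (p x) ⊆ Q b ∨ segment ℝ (p 1) (p y) ⊆ Q b := by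
    obtain ⟨hb, ⟨h1, hx, hy⟩, ⟨hx1, hx8⟩, ⟨hy1, hy8⟩, hxy⟩ := h
    have mx : x ∈ Set.Icc 1 8 := ⟨hx1.le, hx8⟩
    have my : y ∈ Set.Icc 1 8 := ⟨hy1.le, hy8⟩
    exact (hQ b hb).segment_subset_or (Set.mem_image_of_mem p h1) (Set.mem_image_of_mem p hx)
      (Set.mem_image_of_mem p hy) (hp.ne mx my hxy)
  have not_both (b b' : Finset ℕ) (x : ℕ)
      (h : b ∈ sqs8Blocks ∧ b' ∈ sqs8Blocks ∧ b ≠ b' ∧ 1 < x ∧ x ≤ 8) :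
      ¬ (segment ℝ (p 1) (p x) ⊆ Q b ∧ segment ℝ (p 1) (p x) ⊆ Q b') := by
    rintro ⟨hs, hs'⟩
    obtain ⟨hb, hb', hne, hx1, hx8⟩ := h
    have hsub := Set.subset_inter hs hs'
    rw [hdisj b hb b' hb' hne] at hsub
    exact segment_infinite (hp.ne (by simp) ⟨hx1.le, hx8⟩ hx1.ne)
      (((Finset.finite_toSet _).image p).subset hsub)
  -- At corner 1, the blocks 1248, 1467, 1257, 1568 already leave no consistent choice.
  have h₁ := one_of_two {1, 2, 4, 8} 2 4 (by decide)
  have h₂ := one_of_two {1, 4, 6, 7} 4 6 (by decide)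
  have h₃ := one_of_two {1, 4, 6, 7} 4 7 (by decide)
  have h₄ := one_of_two {1, 4, 6, 7} 6 7 (by decide)
  have h₅ := one_of_two {1, 2, 5, 7} 2 5 (by decide)
  have h₆ := one_of_two {1, 2, 5, 7} 2 7 (by decide)
  have h₇ := one_of_two {1, 2, 5, 7} 5 7 (by decide)
  have h₈ := one_of_two {1, 5, 6, 8} 5 6 (by decide)
  have n₂ := not_both {1, 2, 4, 8} {1, 2, 5, 7} 2 (by decide)
  have n₄ := not_both {1, 2, 4, 8} {1, 4, 6, 7} 4 (by decide)
  have n₅ := not_both {1, 2, 5, 7} {1, 5, 6, 8} 5 (by decide)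
  have n₆ := not_both {1, 4, 6, 7} {1, 5, 6, 8} 6 (by decide)
  have n₇ := not_both {1, 4, 6, 7} {1, 2, 5, 7} 7 (by decide)
  rcases h₁ with h | h
  · have five := h₅.resolve_left fun t => n₂ ⟨h, t⟩
    have seven := h₆.resolve_left fun t => n₂ ⟨h, t⟩
    exact n₆ ⟨h₄.resolve_right fun t => n₇ ⟨t, seven⟩, h₈.resolve_left fun t => n₅ ⟨five, t⟩⟩
  · have six := h₂.resolve_left fun t => n₄ ⟨h, t⟩
    have seven := h₃.resolve_left fun t => n₄ ⟨h, t⟩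
    have five := h₇.resolve_right fun t => n₇ ⟨seven, t⟩
    exact n₆ ⟨six, h₈.resolve_left fun t => n₅ ⟨five, t⟩⟩
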